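/- Let ω, v ∈ ℝ³ with ω ≠ 0 and cos ‖ω‖ ≠ 1, write θ = ‖ω‖, K = ω̂, V = v̂. Let D = I + ((1 − cos θ)/θ²) K + ((θ − sin θ)/θ³) K² and C = ((2 − 2cos θ − (θ/2) sin θ)/θ²) V + ((θ − sin θ)/θ³)(KV + VK) + ((1 − cos θ − (θ/2) sin θ)/θ⁴)(K²V + KVK + VK²) + ((θ − (3/2) sin θ + (θ/2) cos θ)/θ⁵)(K²VK + KVK²). Let E = I − (1/2) K + c₂ K² with c₂ = ((1/2)θ sin θ + cos θ − 1)/(θ²(cos θ − 1)), and F = −(1/2) V + c₂ (KV + VK) + c₄ (K²VK + KVK²) with c₄ = ((1/4)θ² + (1/4)θ sin θ + cos θ − 1)/(θ⁴(cos θ − 1)). Then the 6×6 block matrices P = [[D, 0], [C, D]] and Q = [[E, 0], [F, E]] satisfy P · Q = I₆ and Q · P = I₆, where I is the 3×3 identity and I₆ the 6×6 identity matrix. -/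

import Mathlib

open Real

/-- The hat map `∧ : ℝ³ → 𝔰𝔬(3)`. -/
noncomputable def hatSO3 (ω : EuclideanSpace ℝ (Fin 3)) : Matrix (Fin 3) (Fin 3) ℝ :=
  !![0, -ω 2, ω 1; ω 2, 0, -ω 0; -ω 1, ω 0, 0]

open Matrix

theorem hatSO3_pow_three (ω : EuclideanSpace ℝ (Fin 3)) :
    hatSO3 ω ^ 3 = -(‖ω‖ ^ 2 • hatSO3 ω) := by
  rw [EuclideanSpace.real_norm_sq_eq]
  ext i j
  fin_cases i <;> fin_cases j <;>
    simp [hatSO3, pow_succ, Matrix.mul_apply, Fin.sum_univ_three] <;> ring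

theorem hatSO3_mul_hatSO3_mul_hatSO3 (ω v : EuclideanSpace ℝ (Fin 3)) :
    hatSO3 ω * hatSO3 v * hatSO3 ω = -((∑ i, ω i * v i) • hatSO3 ω) := by
  ext i j
  fin_cases i <;> fin_cases j <;>
    simp [hatSO3, Matrix.mul_apply, Fin.sum_univ_three] <;> ring

theorem hatSO3_mul_hatSO3_sq (ω v : EuclideanSpace ℝ (Fin 3)) :
    hatSO3 v * hatSO3 ω ^ 2 =
      -(‖ω‖ ^ 2 • hatSO3 v) - (∑ i, ω i * v i) • hatSO3 ω - hatSO3 ω ^ 2 * hatSO3 v := by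
  rw [EuclideanSpace.real_norm_sq_eq]
  ext i j
  fin_cases i <;> fin_cases j <;>
    simp [hatSO3, pow_succ, Matrix.mul_apply, Fin.sum_univ_three] <;> ring

section Algebra

variable {A : Type*} [Ring A] [Algebra ℝ A] {K V : A} {n m a₁ a₂ b₀ b₁ b₂ c₂ c₄ : ℝ}

/-- Two quadratic polynomials in an element with `K ^ 3 = -n K` multiply to `1` as soon as
the reduced coefficients of their product do. -/
theorem quadratic_mul_quadratic_eq_one (hK : K ^ 3 = -(n • K))
    (h₁ : a₁ - 1 / 2 - n * (a₁ * c₂ - a₂ / 2) = 0)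
    (h₂ : a₂ + c₂ - a₁ / 2 - n * (a₂ * c₂) = 0) :
    (1 + a₁ • K + a₂ • K ^ 2) * (1 - (1 / 2 : ℝ) • K + c₂ • K ^ 2) = 1 := by
  have hK' : K * (K * K) = -(n • K) := by rw [← hK]; noncomm_ring
  simp only [pow_two, mul_add, add_mul, mul_sub, smul_mul_assoc, mul_smul_comm,
    mul_one, one_mul, mul_assoc, hK', mul_neg]
  linear_combination (norm := module) h₁ • K + h₂ • (K * K)

/-- The derivative of `quadratic_mul_quadratic_eq_one` in the direction `V`, where `K` and `V`
satisfy the relations of two skew-symmetric `3 × 3` matrices. -/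
theorem lower_left_block_eq_zero (hK : K ^ 3 = -(n • K)) (hKVK : K * V * K = -(m • K))
    (hVK : V * K ^ 2 = -(n • V) - m • K - K ^ 2 * V)
    (h₀ : b₀ - n * b₁ = a₁)
    (h₁ : a₁ - 1 / 2 - n * (a₁ * c₂ - a₂ / 2) = 0)
    (h₂ : a₂ + c₂ - a₁ / 2 - n * (a₂ * c₂) = 0)
    (h₃ : a₁ * c₂ - a₂ / 2 + b₁ - n * (b₁ * c₂) + n * b₂ / 2 - n * (a₁ * c₄) = 0)
    (h₄ : a₂ * c₂ - b₁ / 2 + b₂ - n * (c₂ * b₂) + c₄ - n * (a₂ * c₄) = 0) :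
    (b₀ • V + a₂ • (K * V + V * K) + b₁ • (K ^ 2 * V + K * V * K + V * K ^ 2)
        + b₂ • (K ^ 2 * V * K + K * V * K ^ 2)) * (1 - (1 / 2 : ℝ) • K + c₂ • K ^ 2)
      + (1 + a₁ • K + a₂ • K ^ 2) * (-((1 / 2 : ℝ) • V) + c₂ • (K * V + V * K)
        + c₄ • (K ^ 2 * V * K + K * V * K ^ 2)) = 0 := by
  have hT : K ^ 2 * V * K + K * V * K ^ 2 = (-2 * m) • K ^ 2 := by
    have e : K ^ 2 * V * K + K * V * K ^ 2 = K * (K * V * K) + K * V * K * K := by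
      noncomm_ring
    rw [e, hKVK, pow_two, mul_neg, neg_mul, mul_smul_comm, smul_mul_assoc]
    module
  have hU : K ^ 2 * V + K * V * K + V * K ^ 2 = -(n • V) - (2 * m) • K := by
    rw [hKVK, hVK]
    module
  have hK' : K * (K * K) = -(n • K) := by rw [← hK]; noncomm_ring
  have hKVK' : K * (V * K) = -(m • K) := by rw [← hKVK, mul_assoc]
  have hVK' : V * (K * K) = -(n • V) - m • K - K * (K * V) := by
    rw [← pow_two, hVK, pow_two, mul_assoc]
  have hK'V : K * (K * (K * V)) = -(n • (K * V)) := by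
    rw [← mul_assoc K K V, ← mul_assoc, hK', neg_mul, smul_mul_assoc]
  rw [hT, hU]
  subst h₀
  simp only [pow_two, mul_add, add_mul, mul_sub, sub_mul, neg_mul, smul_mul_assoc, mul_smul_comm,
    mul_one, one_mul, mul_assoc, hK', hKVK', hVK', hK'V, mul_neg, smul_add, smul_sub, smul_neg]
  linear_combination (norm := module) h₁ • V + h₂ • (K * V + V * K) + (-2 * m) • h₃ • K
    + (-2 * m) • h₄ • (K * K)

end Algebra

/-- The claimed exact block-matrix expression `Q = [[E, 0], [F, E]]` for `dexp⁻¹` on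
`SE(3)` is the two-sided inverse of the closed form `P = [[D, 0], [C, D]]` of `dexp`
on `SE(3)`. -/
theorem dexp_inv_se3 (ω v : EuclideanSpace ℝ (Fin 3)) (hω : ω ≠ 0)
    (hcos : cos ‖ω‖ ≠ 1)
    (θ : ℝ) (hθ : θ = ‖ω‖)
    (K V : Matrix (Fin 3) (Fin 3) ℝ) (hK : K = hatSO3 ω) (hV : V = hatSO3 v)
    (D C E F : Matrix (Fin 3) (Fin 3) ℝ)
    (hD : D = 1 + ((1 - cos θ) / θ ^ 2) • K + ((θ - sin θ) / θ ^ 3) • K ^ 2)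
    (hC : C = ((2 - 2 * cos θ - (θ / 2) * sin θ) / θ ^ 2) • V
      + ((θ - sin θ) / θ ^ 3) • (K * V + V * K)
      + ((1 - cos θ - (θ / 2) * sin θ) / θ ^ 4) • (K ^ 2 * V + K * V * K + V * K ^ 2)
      + ((θ - (3 / 2) * sin θ + (θ / 2) * cos θ) / θ ^ 5) •
          (K ^ 2 * V * K + K * V * K ^ 2))
    (c₂ c₄ : ℝ)
    (hc₂ : c₂ = ((1 / 2) * θ * sin θ + cos θ - 1) / (θ ^ 2 * (cos θ - 1)))
    (hc₄ : c₄ = ((1 / 4) * θ ^ 2 + (1 / 4) * θ * sin θ + cos θ - 1) /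
      (θ ^ 4 * (cos θ - 1)))
    (hE : E = 1 - (1 / 2 : ℝ) • K + c₂ • K ^ 2)
    (hF : F = -((1 / 2 : ℝ) • V) + c₂ • (K * V + V * K)
      + c₄ • (K ^ 2 * V * K + K * V * K ^ 2))
    (P Q : Matrix (Fin 3 ⊕ Fin 3) (Fin 3 ⊕ Fin 3) ℝ)
    (hP : P = Matrix.fromBlocks D 0 C D)
    (hQ : Q = Matrix.fromBlocks E 0 F E) :
    P * Q = 1 ∧ Q * P = 1 := by
  have hθ0 : θ ≠ 0 := by rw [hθ]; exact norm_ne_zero_iff.mpr hω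
  have hc : cos θ - 1 ≠ 0 := by rw [hθ]; exact sub_ne_zero.mpr hcos
  have hs : sin θ ^ 2 = 1 - cos θ ^ 2 := Real.sin_sq θ
  have hK3 : K ^ 3 = -(θ ^ 2 • K) := by rw [hK, hθ]; exact hatSO3_pow_three ω
  have hKVK : K * V * K = -((∑ i, ω i * v i) • K) := by
    rw [hK, hV]; exact hatSO3_mul_hatSO3_mul_hatSO3 ω v
  have hVK : V * K ^ 2 = -(θ ^ 2 • V) - (∑ i, ω i * v i) • K - K ^ 2 * V := by
    rw [hK, hV, hθ]; exact hatSO3_mul_hatSO3_sq ω v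
  have h₁ : (1 - cos θ) / θ ^ 2 - 1 / 2
      - θ ^ 2 * ((1 - cos θ) / θ ^ 2 * c₂ - (θ - sin θ) / θ ^ 3 / 2) = 0 := by
    rw [hc₂]; field_simp; ring
  have h₂ : (θ - sin θ) / θ ^ 3 + c₂ - (1 - cos θ) / θ ^ 2 / 2
      - θ ^ 2 * ((θ - sin θ) / θ ^ 3 * c₂) = 0 := by
    rw [hc₂]; field_simp; ring_nf; simp only [hs]; ring
  have hDE : D * E = 1 := by
    rw [hD, hE]; exact quadratic_mul_quadratic_eq_one hK3 h₁ h₂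
  have hCE : C * E + D * F = 0 := by
    rw [hC, hE, hD, hF]
    refine lower_left_block_eq_zero hK3 hKVK hVK ?_ h₁ h₂ ?_ ?_
    · field_simp; ring
    · rw [hc₂, hc₄]; field_simp; ring_nf; simp only [hs]; ring
    · rw [hc₂, hc₄]; field_simp; ring_nf; simp only [hs]; ring
  have hPQ : P * Q = 1 := by
    rw [hP, hQ, fromBlocks_multiply, hCE, ← fromBlocks_one]
    simp [hDE]
  exact ⟨hPQ, mul_eq_one_comm.mp hPQ⟩
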